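/- Let p ≥ 2, α = p−1 and θ ≥ 0. The constant μ_{α,θ} is sharp for the critical inequality: for every σ > μ_{α,θ} one has TMC(σ,α,θ) = ∞, i.e. the integrals ∫₀^∞ φ_p(σ|u|^{p/(p−1)}) dλ_θ over u ∈ X with ‖u‖ ≤ 1 are unbounded. -/

import Mathlib

open MeasureTheory Real Filter ENNReal

/-- The fractional-dimension spherical volume constant `ω_θ = 2π^((θ+1)/2)/Γ((θ+1)/2)`. -/
noncomputable def omegaW (θ : ℝ) : ℝ := 2 * Real.pi ^ ((θ + 1) / 2) / Real.Gamma ((θ + 1) / 2)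

/-- Weighted integral `∫₀^∞ f dλ_θ = ω_θ ∫₀^∞ f(r) r^θ dr` (for nonnegative integrands,
valued in `ℝ≥0∞`). -/
noncomputable def wInt (θ : ℝ) (f : ℝ → ℝ) : ℝ≥0∞ :=
  ENNReal.ofReal (omegaW θ) *
    ∫⁻ r in Set.Ioi (0 : ℝ), ENNReal.ofReal (f r) * ENNReal.ofReal (r ^ θ)

/-- The weighted Lebesgue norm `‖u‖_{L^q_θ}` (valued in `ℝ≥0∞`). -/
noncomputable def wNorm (θ q : ℝ) (u : ℝ → ℝ) : ℝ≥0∞ :=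
  (wInt θ fun r => |u r| ^ q) ^ (1 / q)

/-- Membership in the weighted Sobolev space `X = X^{1,p}_∞(α,θ)`:
`u` is locally absolutely continuous on `(0,∞)` with a.e. derivative `u'`
(expressed through the fundamental theorem of calculus on compact subintervals),
`u(r) → 0` as `r → ∞`, `‖u‖_{L^p_θ} < ∞` and `‖u'‖_{L^p_α} < ∞`. -/
structure MemX (p α θ : ℝ) (u u' : ℝ → ℝ) : Prop where
  ftc_int : ∀ a b : ℝ, 0 < a → a ≤ b → IntervalIntegrable u' MeasureTheory.volume a b
  ftc : ∀ a b : ℝ, 0 < a → a ≤ b → u b - u a = ∫ t in a..b, u' t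
  lim_zero : Filter.Tendsto u Filter.atTop (nhds 0)
  fin_u : wNorm θ p u < ⊤
  fin_u' : wNorm α p u' < ⊤

/-- Full norm on `X`: `‖u‖ = (‖u‖_{L^p_θ}^p + ‖u'‖_{L^p_α}^p)^{1/p}`. -/
noncomputable def Xnorm (p α θ : ℝ) (u u' : ℝ → ℝ) : ℝ≥0∞ :=
  ((wNorm θ p u) ^ p + (wNorm α p u') ^ p) ^ (1 / p)

/-- The truncated exponential `φ_p(t) = Σ_{j ∈ ℕ, j ≥ p-1} t^j / j!`. -/
noncomputable def phiP (p t : ℝ) : ℝ :=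
  ∑' j : ℕ, if p - 1 ≤ (j : ℝ) then t ^ j / (Nat.factorial j : ℝ) else 0

/-- The critical constant `μ_{α,θ} = (θ+1) ω_α^{1/α}`. -/
noncomputable def muC (α θ : ℝ) : ℝ := (θ + 1) * (omegaW α) ^ (1 / α)

/-- The Trudinger–Moser functional `∫₀^∞ φ_p(μ |u|^{p/(p-1)}) dλ_θ`. -/
noncomputable def TMfunc (p θ μ : ℝ) (u : ℝ → ℝ) : ℝ≥0∞ :=
  wInt θ fun r => phiP p (μ * |u r| ^ (p / (p - 1)))

/-- The subcritical Trudinger–Moser supremum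
`TMSC(μ,α,θ) = sup { ‖u‖_{L^p_θ}^{-p} ∫₀^∞ φ_p(μ|u|^{p/(p-1)}) dλ_θ : u ∈ X, u ≠ 0, ‖u'‖_{L^p_α} ≤ 1 }`. -/
noncomputable def TMSC (p α θ μ : ℝ) : ℝ≥0∞ :=
  ⨆ (u : ℝ → ℝ) (u' : ℝ → ℝ) (_ : MemX p α θ u u') (_ : u ≠ 0)
    (_ : wNorm α p u' ≤ 1), (wNorm θ p u) ^ (-p) * TMfunc p θ μ u

/-- The critical Trudinger–Moser supremum
`TMC(σ,α,θ) = sup { ∫₀^∞ φ_p(σ|u|^{p/(p-1)}) dλ_θ : u ∈ X, ‖u‖ ≤ 1 }`. -/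
noncomputable def TMC (p α θ σ : ℝ) : ℝ≥0∞ :=
  ⨆ (u : ℝ → ℝ) (u' : ℝ → ℝ) (_ : MemX p α θ u u') (_ : Xnorm p α θ u u' ≤ 1),
    TMfunc p θ σ u

/-- `k₀ = min { j ∈ ℕ : j ≥ p - 1 }`. -/
noncomputable def k0 (p : ℝ) : ℕ := sInf {j : ℕ | p - 1 ≤ (j : ℝ)}

/-- `TMC(σ,α,θ)` is attained by some `u ∈ X` with `‖u‖ ≤ 1`. -/
def TMCAttained (p α θ σ : ℝ) : Prop :=
  ∃ u u' : ℝ → ℝ, MemX p α θ u u' ∧ Xnorm p α θ u u' ≤ 1 ∧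
    TMC p α θ σ = TMfunc p θ σ u

/-- `σ_* = inf { σ ∈ (0, μ_{α,θ}) : TMC(σ,α,θ) is attained }`. -/
noncomputable def sigmaStar (p α θ : ℝ) : ℝ :=
  sInf {σ : ℝ | σ ∈ Set.Ioo 0 (muC α θ) ∧ TMCAttained p α θ σ}

theorem omegaW_pos {θ : ℝ} (hθ : -1 < θ) : 0 < omegaW θ := by
  have : 0 < Real.Gamma ((θ + 1) / 2) := Real.Gamma_pos_of_pos (by linarith)
  unfold omegaW
  positivity

/-- The truncation of `r` to the interval `[exp (-L), 1]`. -/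
noncomputable def clampExp (L r : ℝ) : ℝ := max (Real.exp (-L)) (min r 1)

/-- The Moser function of height `A * L`. -/
noncomputable def moser (A L r : ℝ) : ℝ := A * -Real.log (clampExp L r)

/-- The derivative of the Moser function. -/
noncomputable def moserDeriv (A L : ℝ) : ℝ → ℝ :=
  (Set.Ioc (Real.exp (-L)) 1).indicator fun r => A * -r⁻¹

theorem clampExp_pos (L r : ℝ) : 0 < clampExp L r :=
  lt_of_lt_of_le (Real.exp_pos _) (le_max_left _ _)

theorem moser_of_le {A L r : ℝ} (hr : r ≤ Real.exp (-L)) :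
    moser A L r = A * L := by
  have : clampExp L r = Real.exp (-L) := max_eq_left (le_trans (min_le_left _ _) hr)
  rw [moser, this, Real.log_exp, neg_neg]

theorem moser_of_one_le {A L r : ℝ} (hL : 0 ≤ L) (hr : 1 ≤ r) : moser A L r = 0 := by
  have h1 : Real.exp (-L) ≤ 1 := Real.exp_le_one_iff.2 (by linarith)
  have : clampExp L r = 1 := by rw [clampExp, min_eq_right hr, max_eq_right h1]
  simp [moser, this]

theorem moser_nonneg {A L : ℝ} (hA : 0 ≤ A) (hL : 0 ≤ L) (r : ℝ) : 0 ≤ moser A L r := by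
  have h1 : Real.exp (-L) ≤ 1 := Real.exp_le_one_iff.2 (by linarith)
  have h2 : clampExp L r ≤ 1 := max_le h1 (min_le_right _ _)
  exact mul_nonneg hA (neg_nonneg.2 (Real.log_nonpos (clampExp_pos L r).le h2))

theorem moser_le {A L r : ℝ} (hA : 0 ≤ A) (hr : 0 < r) (hr1 : r ≤ 1) :
    moser A L r ≤ A * -Real.log r := by
  have h2 : r ≤ clampExp L r := by
    rw [clampExp, min_eq_left hr1]
    exact le_max_right _ _
  exact mul_le_mul_of_nonneg_left (neg_le_neg (Real.log_le_log hr h2)) hA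

theorem Ioc_inter_eq_Ioc_clampExp (L a b : ℝ) :
    Set.Ioc a b ∩ Set.Ioc (Real.exp (-L)) 1 = Set.Ioc (clampExp L a) (clampExp L b) := by
  by_cases h : Real.exp (-L) ≤ 1
  · ext x
    simp only [Set.mem_inter_iff, Set.mem_Ioc, clampExp, max_lt_iff, le_max_iff, min_lt_iff,
      le_min_iff]
    grind
  · rw [not_le] at h
    rw [Set.Ioc_eq_empty_of_le h.le, Set.inter_empty]
    have hc : ∀ x, clampExp L x = Real.exp (-L) := fun x =>
      max_eq_left (le_trans (min_le_right _ _) h.le)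
    rw [hc, hc, Set.Ioc_self]

theorem clampExp_mono (L : ℝ) : Monotone (clampExp L) := fun _ _ h =>
  max_le_max le_rfl (min_le_min h le_rfl)

theorem moserDeriv_intervalIntegrable (A L a b : ℝ) :
    IntervalIntegrable (moserDeriv A L) volume a b := by
  have h : IntegrableOn (fun r : ℝ => A * -r⁻¹) (Set.Ioc (Real.exp (-L)) 1) volume := by
    have hc : ContinuousOn (fun r : ℝ => A * -r⁻¹) (Set.Icc (Real.exp (-L)) 1) := by
      refine continuousOn_const.mul (ContinuousOn.neg (continuousOn_inv₀.mono ?_))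
      intro x hx
      exact (lt_of_lt_of_le (Real.exp_pos _) hx.1).ne'
    exact hc.integrableOn_Icc.mono_set Set.Ioc_subset_Icc_self
  exact ((integrable_indicator_iff measurableSet_Ioc).2 h).intervalIntegrable

theorem integral_moserDeriv (A L : ℝ) {a b : ℝ} (hab : a ≤ b) :
    ∫ t in a..b, moserDeriv A L t = moser A L b - moser A L a := by
  rw [intervalIntegral.integral_of_le hab, moserDeriv, setIntegral_indicator measurableSet_Ioc,
    Ioc_inter_eq_Ioc_clampExp, ← intervalIntegral.integral_of_le (clampExp_mono L hab),
    intervalIntegral.integral_const_mul, intervalIntegral.integral_neg,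
    integral_inv_of_pos (clampExp_pos L a) (clampExp_pos L b),
    Real.log_div (clampExp_pos L b).ne' (clampExp_pos L a).ne', moser, moser]
  ring

theorem wNorm_rpow {p : ℝ} (hp : p ≠ 0) (θ : ℝ) (u : ℝ → ℝ) :
    wNorm θ p u ^ p = wInt θ fun r => |u r| ^ p := by
  rw [wNorm, ← ENNReal.rpow_mul, one_div_mul_cancel hp, ENNReal.rpow_one]

theorem lintegral_neg_log_rpow_lt_top {p : ℝ} (hp : 0 < p) :
    ∫⁻ r in Set.Ioc (0 : ℝ) 1, ENNReal.ofReal ((-Real.log r) ^ p) < ⊤ := by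
  have hi : IntegrableOn (fun r : ℝ => (2 * p) ^ p * r ^ (-(1 / 2) : ℝ)) (Set.Ioc 0 1) := by
    have := intervalIntegral.intervalIntegrable_rpow' (a := 0) (b := 1) (r := -(1 / 2))
      (by norm_num)
    exact ((intervalIntegrable_iff_integrableOn_Ioc_of_le zero_le_one).1 this).const_mul _
  refine lt_of_le_of_lt (setLIntegral_mono' measurableSet_Ioc fun r hr => ?_) hi.lintegral_lt_top
  apply ENNReal.ofReal_le_ofReal
  have h0 : 0 ≤ -Real.log r := neg_nonneg.2 (Real.log_nonpos hr.1.le hr.2)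
  have h1 : -Real.log r ≤ 2 * p * r ^ (-(1 / (2 * p))) := by
    have := Real.log_le_rpow_div (inv_nonneg.2 hr.1.le) (ε := 1 / (2 * p)) (by positivity)
    rw [Real.log_inv, Real.inv_rpow hr.1.le, ← Real.rpow_neg hr.1.le] at this
    calc _ ≤ _ := this
      _ = _ := by field_simp
  calc (-Real.log r) ^ p ≤ (2 * p * r ^ (-(1 / (2 * p)))) ^ p :=
        Real.rpow_le_rpow h0 h1 hp.le
    _ = _ := by
        rw [Real.mul_rpow (by positivity) (Real.rpow_nonneg hr.1.le _), ← Real.rpow_mul hr.1.le]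
        congr 2
        field_simp

theorem wInt_moser_le {p θ A L : ℝ} (hp : 0 < p) (hθ : 0 ≤ θ) (hA : 0 ≤ A) (hL : 0 ≤ L) :
    wInt θ (fun r => |moser A L r| ^ p) ≤ ENNReal.ofReal (omegaW θ) * (ENNReal.ofReal (A ^ p) *
      ∫⁻ r in Set.Ioc (0 : ℝ) 1, ENNReal.ofReal ((-Real.log r) ^ p)) := by
  unfold wInt
  gcongr
  rw [← lintegral_const_mul' _ _ ENNReal.ofReal_ne_top, ← lintegral_indicator measurableSet_Ioi,
    ← lintegral_indicator measurableSet_Ioc]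
  refine lintegral_mono fun r => ?_
  by_cases hr0 : 0 < r
  · rw [Set.indicator_of_mem (Set.mem_Ioi.2 hr0)]
    by_cases hr1 : r ≤ 1
    · rw [Set.indicator_of_mem (Set.mem_Ioc.2 ⟨hr0, hr1⟩)]
      have h0 : 0 ≤ -Real.log r := neg_nonneg.2 (Real.log_nonpos hr0.le hr1)
      rw [← ENNReal.ofReal_mul (by positivity), ← ENNReal.ofReal_mul (by positivity)]
      apply ENNReal.ofReal_le_ofReal
      simp only
      rw [abs_of_nonneg (moser_nonneg hA hL r), ← Real.mul_rpow hA h0]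
      calc moser A L r ^ p * r ^ θ ≤ (A * -Real.log r) ^ p * 1 := by
            gcongr
            · exact moser_nonneg hA hL r
            · exact moser_le hA hr0 hr1
            · exact Real.rpow_le_one hr0.le hr1 hθ
        _ = _ := mul_one _
    · simp [moser_of_one_le hL (not_le.1 hr1).le, Real.zero_rpow hp.ne']
  · rw [Set.indicator_of_notMem (by simpa using hr0)]
    exact zero_le

theorem wInt_moserDeriv_le {p A L : ℝ} (hp : 0 < p) (hA : 0 ≤ A) (hL : 0 ≤ L) :
    wInt (p - 1) (fun r => |moserDeriv A L r| ^ p) ≤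
      ENNReal.ofReal (omegaW (p - 1)) * ENNReal.ofReal (A ^ p * L) := by
  unfold wInt
  gcongr
  have hE : Real.exp (-L) ≤ 1 := Real.exp_le_one_iff.2 (by linarith)
  have hi : IntegrableOn (fun r : ℝ => A ^ p * r⁻¹) (Set.Ioc (Real.exp (-L)) 1) := by
    have hc : ContinuousOn (fun r : ℝ => A ^ p * r⁻¹) (Set.Icc (Real.exp (-L)) 1) := by
      refine continuousOn_const.mul (continuousOn_inv₀.mono ?_)
      intro x hx
      exact (lt_of_lt_of_le (Real.exp_pos _) hx.1).ne'
    exact hc.integrableOn_Icc.mono_set Set.Ioc_subset_Icc_self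
  have hv : A ^ p * L = ∫ r in Set.Ioc (Real.exp (-L)) 1, A ^ p * r⁻¹ := by
    rw [← intervalIntegral.integral_of_le hE, intervalIntegral.integral_const_mul,
      integral_inv_of_pos (Real.exp_pos _) one_pos]
    simp
  rw [hv, ofReal_integral_eq_lintegral_ofReal hi ?_, ← lintegral_indicator measurableSet_Ioi,
    ← lintegral_indicator measurableSet_Ioc]
  · refine lintegral_mono fun r => ?_
    by_cases hr0 : 0 < r
    · rw [Set.indicator_of_mem (Set.mem_Ioi.2 hr0)]
      by_cases hr : r ∈ Set.Ioc (Real.exp (-L)) 1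
      · simp only [moserDeriv]
        rw [Set.indicator_of_mem hr, Set.indicator_of_mem hr, ← ENNReal.ofReal_mul (by positivity)]
        apply ENNReal.ofReal_le_ofReal
        rw [abs_mul, abs_neg, abs_of_nonneg hA, abs_of_pos (inv_pos.2 hr0),
          Real.mul_rpow hA (inv_nonneg.2 hr0.le), Real.inv_rpow hr0.le, Real.rpow_sub hr0,
          Real.rpow_one]
        have : r ^ p ≠ 0 := (Real.rpow_pos_of_pos hr0 p).ne'
        apply le_of_eq
        field_simp
      · simp only [moserDeriv]
        rw [Set.indicator_of_notMem hr, Set.indicator_of_notMem hr]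
        simp [Real.zero_rpow hp.ne']
    · rw [Set.indicator_of_notMem (by simpa using hr0)]
      exact zero_le
  · filter_upwards [ae_restrict_mem measurableSet_Ioc] with r hr
    have : 0 < r := (Real.exp_pos _).trans hr.1
    positivity

theorem phiP_eq (p t : ℝ) :
    phiP p t = Real.exp t - ∑ j ∈ Finset.range ⌈p - 1⌉₊, t ^ j / (Nat.factorial j : ℝ) := by
  have hs := Real.summable_pow_div_factorial t
  have he : Real.exp t = ∑' j : ℕ, t ^ j / (Nat.factorial j : ℝ) := by
    rw [Real.exp_eq_exp_ℝ, NormedSpace.exp_eq_tsum_div]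
  have hf : ∀ j : ℕ, (if p - 1 ≤ (j : ℝ) then t ^ j / (Nat.factorial j : ℝ) else 0) =
      t ^ j / (Nat.factorial j : ℝ) -
        if j ∈ Finset.range ⌈p - 1⌉₊ then t ^ j / (Nat.factorial j : ℝ) else 0 := by
    intro j
    simp only [Finset.mem_range, Nat.lt_ceil]
    split_ifs <;> linarith
  have hs2 := hasSum_sum_of_ne_finset_zero (L := .unconditional ℕ) (s := Finset.range ⌈p - 1⌉₊)
    (f := fun j => if j ∈ Finset.range ⌈p - 1⌉₊ then t ^ j / (Nat.factorial j : ℝ) else 0)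
    (fun j hj => if_neg hj)
  unfold phiP
  rw [tsum_congr hf, hs.tsum_sub hs2.summable, hs2.tsum_eq, ← he]
  congr 1
  exact Finset.sum_congr rfl fun j hj => if_pos hj

theorem eventually_exp_div_two_le_phiP (p : ℝ) :
    ∀ᶠ t in atTop, Real.exp t / 2 ≤ phiP p t := by
  have h : Tendsto (fun t : ℝ => ∑ j ∈ Finset.range ⌈p - 1⌉₊,
      (t ^ j * Real.exp (-t)) / (Nat.factorial j : ℝ)) atTop (nhds 0) := by
    have := tendsto_finsetSum (Finset.range ⌈p - 1⌉₊) fun j _ =>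
      (Real.tendsto_pow_mul_exp_neg_atTop_nhds_zero j).div_const (Nat.factorial j : ℝ)
    simpa using this
  filter_upwards [h.eventually (gt_mem_nhds (show (0 : ℝ) < 1 / 2 by norm_num))] with t ht
  have h2 : ∑ j ∈ Finset.range ⌈p - 1⌉₊, t ^ j / (Nat.factorial j : ℝ) =
      Real.exp t * ∑ j ∈ Finset.range ⌈p - 1⌉₊, (t ^ j * Real.exp (-t)) / (Nat.factorial j : ℝ) := by
    rw [Finset.mul_sum]
    refine Finset.sum_congr rfl fun j _ => ?_
    rw [Real.exp_neg]
    field_simp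
  rw [phiP_eq, h2]
  nlinarith [Real.exp_pos t]

theorem le_TMfunc_moser {p θ σ A L : ℝ} (hθ : -1 < θ) (hA : 0 ≤ A) (hL : 0 ≤ L)
    (hφ : 0 ≤ phiP p (σ * (A * L) ^ (p / (p - 1)))) :
    ENNReal.ofReal (omegaW θ / (θ + 1) * phiP p (σ * (A * L) ^ (p / (p - 1))) *
      Real.exp (-((θ + 1) * L))) ≤ TMfunc p θ σ (moser A L) := by
  have hi : IntegrableOn (fun r : ℝ => phiP p (σ * (A * L) ^ (p / (p - 1))) * r ^ θ)
      (Set.Ioc 0 (Real.exp (-L))) := by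
    have := intervalIntegral.intervalIntegrable_rpow' (a := 0) (b := Real.exp (-L)) hθ
    exact ((intervalIntegrable_iff_integrableOn_Ioc_of_le (Real.exp_pos _).le).1 this).const_mul _
  have hv : ∫ r in Set.Ioc 0 (Real.exp (-L)), phiP p (σ * (A * L) ^ (p / (p - 1))) * r ^ θ =
      phiP p (σ * (A * L) ^ (p / (p - 1))) * (Real.exp (-((θ + 1) * L)) / (θ + 1)) := by
    rw [← intervalIntegral.integral_of_le (Real.exp_pos _).le,
      intervalIntegral.integral_const_mul, integral_rpow (Or.inl hθ),
      Real.zero_rpow (by linarith), ← Real.exp_mul]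
    ring_nf
  have hnn : 0 ≤ᵐ[volume.restrict (Set.Ioc 0 (Real.exp (-L)))]
      fun r : ℝ => phiP p (σ * (A * L) ^ (p / (p - 1))) * r ^ θ := by
    filter_upwards [ae_restrict_mem measurableSet_Ioc] with r hr
    exact mul_nonneg hφ (Real.rpow_nonneg hr.1.le _)
  rw [show omegaW θ / (θ + 1) * phiP p (σ * (A * L) ^ (p / (p - 1))) *
      Real.exp (-((θ + 1) * L)) = omegaW θ * (phiP p (σ * (A * L) ^ (p / (p - 1))) *
      (Real.exp (-((θ + 1) * L)) / (θ + 1))) by ring, ENNReal.ofReal_mul (omegaW_pos hθ).le,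
    ← hv, ofReal_integral_eq_lintegral_ofReal hi hnn, TMfunc, wInt]
  refine mul_le_mul' le_rfl ?_
  refine (setLIntegral_mono' measurableSet_Ioc fun r hr => ?_).trans
    (lintegral_mono_set Set.Ioc_subset_Ioi_self)
  rw [moser_of_le hr.2, abs_of_nonneg (mul_nonneg hA hL), ENNReal.ofReal_mul hφ]

theorem memX_moser {p θ A L : ℝ} (hp : 0 < p) (hθ : 0 ≤ θ) (hA : 0 ≤ A) (hL : 0 ≤ L) :
    MemX p (p - 1) θ (moser A L) (moserDeriv A L) where
  ftc_int a b _ _ := moserDeriv_intervalIntegrable A L a b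
  ftc _ _ _ hab := (integral_moserDeriv A L hab).symm
  lim_zero := tendsto_const_nhds.congr' <| by
    filter_upwards [eventually_ge_atTop 1] with r hr using (moser_of_one_le hL hr).symm
  fin_u := ENNReal.rpow_lt_top_of_nonneg (by positivity) <| ne_top_of_le_ne_top
    (ENNReal.mul_ne_top ENNReal.ofReal_ne_top (ENNReal.mul_ne_top ENNReal.ofReal_ne_top
      (lintegral_neg_log_rpow_lt_top hp).ne)) (wInt_moser_le hp hθ hA hL)
  fin_u' := ENNReal.rpow_lt_top_of_nonneg (by positivity) <| ne_top_of_le_ne_top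
    (ENNReal.mul_ne_top ENNReal.ofReal_ne_top ENNReal.ofReal_ne_top)
    (wInt_moserDeriv_le hp hA hL)

theorem exists_Xnorm_moser_le_one {p θ : ℝ} (hp : 0 < p) (hθ : 0 ≤ θ) :
    ∃ D : ℝ, 0 ≤ D ∧ ∀ A L : ℝ, 0 ≤ A → 0 ≤ L → A ^ p * (omegaW (p - 1) * L + D) ≤ 1 →
      Xnorm p (p - 1) θ (moser A L) (moserDeriv A L) ≤ 1 := by
  set C := ∫⁻ r in Set.Ioc (0 : ℝ) 1, ENNReal.ofReal ((-Real.log r) ^ p) with hC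
  have hCtop : C ≠ ⊤ := (lintegral_neg_log_rpow_lt_top hp).ne
  have hω := (omegaW_pos (θ := θ) (by linarith)).le
  have hωα := (omegaW_pos (θ := p - 1) (by linarith)).le
  refine ⟨omegaW θ * C.toReal, by positivity, fun A L hA hL h => ?_⟩
  rw [Xnorm, wNorm_rpow hp.ne', wNorm_rpow hp.ne']
  refine ENNReal.rpow_le_one ?_ (by positivity)
  refine (add_le_add (wInt_moser_le hp hθ hA hL) (wInt_moserDeriv_le hp hA hL)).trans ?_
  rw [← hC, ← ENNReal.ofReal_toReal hCtop, ← ENNReal.ofReal_mul (by positivity),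
    ← ENNReal.ofReal_mul hω, ← ENNReal.ofReal_mul hωα,
    ← ENNReal.ofReal_add (by positivity) (by positivity), ← ENNReal.ofReal_one]
  apply ENNReal.ofReal_le_ofReal
  linarith

/-- The normalising factor of the Moser function of logarithmic width `L`. -/
noncomputable def moserCoeff (p w D L : ℝ) : ℝ := (w * L + D)⁻¹ ^ (1 / p)

theorem eventually_mul_le_moserCoeff {p w D κ σ : ℝ} (hp : 1 < p) (hw : 0 < w) (hD : 0 ≤ D)
    (hκ : κ * w ^ (1 / (p - 1)) < σ) :
    ∀ᶠ L in atTop, κ * L ≤ σ * (moserCoeff p w D L * L) ^ (p / (p - 1)) := by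
  have hlim : Tendsto (fun L : ℝ => σ * ((w + D / L)⁻¹) ^ (1 / (p - 1))) atTop
      (nhds (σ * ((w + 0)⁻¹) ^ (1 / (p - 1)))) := by
    have h1 : Tendsto (fun L : ℝ => w + D / L) atTop (nhds (w + 0)) :=
      tendsto_const_nhds.add (tendsto_const_nhds.div_atTop tendsto_id)
    exact ((h1.inv₀ (by simpa using hw.ne')).rpow_const
      (Or.inl (by simpa using hw.ne'))).const_mul σ
  have hlt : κ < σ * ((w + 0)⁻¹) ^ (1 / (p - 1)) := by
    rw [add_zero, Real.inv_rpow hw.le, ← div_eq_mul_inv, lt_div_iff₀ (Real.rpow_pos_of_pos hw _)]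
    exact hκ
  filter_upwards [hlim.eventually (lt_mem_nhds hlt), eventually_gt_atTop 0] with L hL hL0
  have hp1 : 0 < p - 1 := by linarith
  have hp0 : 0 < p := by linarith
  have hwL : 0 < w * L + D := by positivity
  have heq : (moserCoeff p w D L * L) ^ (p / (p - 1)) = (w + D / L)⁻¹ ^ (1 / (p - 1)) * L := by
    have e1 : (w + D / L)⁻¹ = (w * L + D)⁻¹ * L := by field_simp
    rw [moserCoeff, e1, Real.mul_rpow (by positivity) hL0.le,
      Real.mul_rpow (by positivity) hL0.le, ← Real.rpow_mul (by positivity), mul_assoc,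
      ← Real.rpow_add_one hL0.ne']
    congr 2
    · field_simp
    · field_simp
      ring
  rw [heq, ← mul_assoc]
  gcongr

theorem stmt_4 (p α θ : ℝ) (hp : 2 ≤ p) (hα : α = p - 1) (hθ : 0 ≤ θ) :
    ∀ σ : ℝ, muC α θ < σ → TMC p α θ σ = ⊤ := by
  intro σ hσ
  subst hα
  have hp0 : 0 < p := by linarith
  have hp1 : 0 < p - 1 := by linarith
  have hw : 0 < omegaW (p - 1) := omegaW_pos (by linarith)
  have hωθ : 0 < omegaW θ := omegaW_pos (by linarith)
  obtain ⟨D, hD, hnorm⟩ := exists_Xnorm_moser_le_one hp0 hθ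
  obtain ⟨κ, hκ1, hκ2⟩ : ∃ κ, θ + 1 < κ ∧ κ * omegaW (p - 1) ^ (1 / (p - 1)) < σ := by
    have hpos : 0 < omegaW (p - 1) ^ (1 / (p - 1)) := Real.rpow_pos_of_pos hw _
    obtain ⟨κ, h1, h2⟩ := exists_between ((lt_div_iff₀ hpos).2 hσ)
    exact ⟨κ, h1, (lt_div_iff₀ hpos).1 h2⟩
  have hκ0 : 0 < κ := by linarith
  have hT := eventually_mul_le_moserCoeff (p := p) (D := D) (by linarith) hw hD hκ2
  have hTtop : Tendsto (fun L => σ * (moserCoeff p (omegaW (p - 1)) D L * L) ^ (p / (p - 1)))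
      atTop atTop := tendsto_atTop_mono' _ hT (tendsto_id.const_mul_atTop hκ0)
  have hgrow : Tendsto (fun L => omegaW θ / (θ + 1) * (Real.exp ((κ - (θ + 1)) * L) / 2))
      atTop atTop :=
    ((Real.tendsto_exp_atTop.comp (tendsto_id.const_mul_atTop (sub_pos.2 hκ1))).atTop_div_const
      two_pos).const_mul_atTop (by positivity)
  refine ENNReal.eq_top_of_forall_nnreal_le fun M => ?_
  obtain ⟨L, hTL, hφ, hM, hL⟩ := (hT.and ((hTtop.eventually
    (eventually_exp_div_two_le_phiP p)).and ((hgrow.eventually_ge_atTop (M : ℝ)).and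
      (eventually_gt_atTop 0)))).exists
  have hwL : 0 < omegaW (p - 1) * L + D := by positivity
  set A := moserCoeff p (omegaW (p - 1)) D L with hAdef
  have hA : 0 ≤ A := Real.rpow_nonneg (inv_nonneg.2 hwL.le) _
  have hAp : A ^ p * (omegaW (p - 1) * L + D) ≤ 1 := by
    rw [hAdef, moserCoeff, ← Real.rpow_mul (inv_nonneg.2 hwL.le), one_div_mul_cancel hp0.ne',
      Real.rpow_one, inv_mul_cancel₀ hwL.ne']
  set T := σ * (A * L) ^ (p / (p - 1)) with hTdef
  have hlow : (M : ℝ) ≤ omegaW θ / (θ + 1) * phiP p T * Real.exp (-((θ + 1) * L)) := by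
    calc (M : ℝ) ≤ omegaW θ / (θ + 1) * (Real.exp ((κ - (θ + 1)) * L) / 2) := hM
      _ = omegaW θ / (θ + 1) * (Real.exp (κ * L) / 2) * Real.exp (-((θ + 1) * L)) := by
          rw [show (κ - (θ + 1)) * L = κ * L + -((θ + 1) * L) by ring, Real.exp_add]
          ring
      _ ≤ omegaW θ / (θ + 1) * phiP p T * Real.exp (-((θ + 1) * L)) := by
          gcongr
          exact le_trans (by gcongr) hφ
  have hTM := le_TMfunc_moser (θ := θ) (by linarith) hA hL.le (le_trans (by positivity) hφ)
  calc (M : ℝ≥0∞) = ENNReal.ofReal M := (ENNReal.ofReal_coe_nnreal).symm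
    _ ≤ TMfunc p θ σ (moser A L) := (ENNReal.ofReal_le_ofReal hlow).trans hTM
    _ ≤ TMC p (p - 1) θ σ :=
        le_iSup_of_le (moser A L) <| le_iSup_of_le (moserDeriv A L) <|
          le_iSup_of_le (memX_moser hp0 hθ hA hL.le) <|
            le_iSup_of_le (hnorm A L hA hL.le hAp) le_rfl
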